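/- Let p : (0, ∞) → ℝ be continuously differentiable with 0 < p′ < 1, F an antiderivative of ω ↦ √(p′(ω))/(ω + p(ω)), A, B positive functions, and κ a constant. Suppose ρ, v : ℝ² → ℝ are differentiable at a point (t, r) with r > 0, ρ(t, r) > 0, |v(t, r)| < 1, and the pair V = (ρ, v)ᵀ satisfies ∂V/∂t + J ∂V/∂r = H at (t, r). Set c_s = √(p′(ρ)), λ± = √(AB)(v ± c_s)/(1 ± v c_s), s₋ = H₂/(1 − v²) + c_s H₁/(ρ + p), and ψ₋ = ½ ln((1 + v)/(1 − v)) + F(ρ). Then at (t, r): (c_s/(ρ + p))·(∂ρ/∂t) + (1/(1 − v²))·(∂v/∂t) = (λ₊/(λ₊ − λ₋))·(∂ψ₋/∂t + λ₋ ∂ψ₋/∂r) − (λ₋/(λ₊ − λ₋))·s₋. -/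

import Mathlib

/-- Partial derivative with respect to the first (time) variable. -/
noncomputable def pdt (f : ℝ × ℝ → ℝ) (x : ℝ × ℝ) : ℝ := fderiv ℝ f x (1, 0)

/-- Partial derivative with respect to the second (radial) variable. -/
noncomputable def pdr (f : ℝ × ℝ → ℝ) (x : ℝ × ℝ) : ℝ := fderiv ℝ f x (0, 1)

/-- If `F` is an antiderivative of `√p' / (ω + p)` on `(0, ∞)`, the denominator has no zero there:
next to a zero the derivative of `F` would tend to infinity. -/
theorem add_ne_zero_of_hasDerivAt_sqrt_div {p F : ℝ → ℝ}
    (hp : ContDiffOn ℝ 1 p (Set.Ioi 0)) (hp' : ∀ ω ∈ Set.Ioi (0 : ℝ), 0 < deriv p ω)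
    (hF : ∀ ω ∈ Set.Ioi (0 : ℝ), HasDerivAt F (Real.sqrt (deriv p ω) / (ω + p ω)) ω)
    {a : ℝ} (ha : 0 < a) : a + p a ≠ 0 := by
  intro h0
  have hcont : ContinuousOn p (Set.Ioi 0) := hp.continuousOn
  have hmono : StrictMonoOn p (Set.Ioi 0) :=
    strictMonoOn_of_deriv_pos (convex_Ioi 0) hcont fun x hx => hp' x (by simpa using hx)
  have hderiv : ContinuousAt (deriv p) a :=
    (hp.continuousOn_deriv_of_isOpen isOpen_Ioi le_rfl).continuousAt (Ioi_mem_nhds ha)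
  have hnum : Filter.Tendsto (fun ω => Real.sqrt (deriv p ω)) (nhdsWithin a (Set.Ioi a))
      (nhds (Real.sqrt (deriv p a))) :=
    hderiv.sqrt.tendsto.mono_left nhdsWithin_le_nhds
  have hden : Filter.Tendsto (fun ω => ω + p ω) (nhdsWithin a (Set.Ioi a))
      (nhdsWithin 0 (Set.Ioi 0)) := by
    refine tendsto_nhdsWithin_iff.2 ⟨?_, ?_⟩
    · have hadd : ContinuousAt (fun ω => ω + p ω) a :=
        continuousAt_id.add (hcont.continuousAt (Ioi_mem_nhds ha))
      simpa only [h0] using hadd.tendsto.mono_left (nhdsWithin_le_nhds (s := Set.Ioi a))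
    · filter_upwards [self_mem_nhdsWithin] with ω hω
      have hω' : a < ω := hω
      have := hmono (Set.mem_Ioi.2 ha) (Set.mem_Ioi.2 (ha.trans hω')) hω'
      simp only [Set.mem_Ioi]
      linarith
  have hlim : Filter.Tendsto (deriv F) (nhdsWithin a (Set.Ioi a)) Filter.atTop := by
    refine (hnum.pos_mul_atTop (Real.sqrt_pos.2 (hp' a ha)) hden.inv_tendsto_nhdsGT_zero).congr' ?_
    filter_upwards [self_mem_nhdsWithin] with ω hω
    rw [(hF ω (ha.trans hω)).deriv, div_eq_mul_inv, Pi.inv_apply]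
  exact not_differentiableWithinAt_of_deriv_tendsto_atTop_Ioi F hlim
    (hF a ha).differentiableAt.differentiableWithinAt

/-- The derivative of `½ ln((1 + v)/(1 - v)) + F(ρ)` at a point where `|v| < 1`. -/
theorem hasFDerivAt_half_log_add_comp {E : Type*} [NormedAddCommGroup E] [NormedSpace ℝ E]
    {ρ v : E → ℝ} {ρ' v' : E →L[ℝ] ℝ} {F : ℝ → ℝ} {F' : ℝ} {x : E}
    (hρ : HasFDerivAt ρ ρ' x) (hv : HasFDerivAt v v' x) (hF : HasDerivAt F F' (ρ x))
    (hvx : |v x| < 1) :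
    HasFDerivAt (fun y => (1 / 2) * Real.log ((1 + v y) / (1 - v y)) + F (ρ y))
      ((1 / (1 - v x ^ 2)) • v' + F' • ρ') x := by
  obtain ⟨h₁, h₂⟩ := abs_lt.1 hvx
  have hplus : 1 + v x ≠ 0 := by linarith
  have hminus : 1 - v x ≠ 0 := by linarith
  have hsq : 1 - v x ^ 2 ≠ 0 := by nlinarith
  have hlog : HasDerivAt (fun w : ℝ => (1 / 2) * Real.log ((1 + w) / (1 - w)))
      (1 / (1 - v x ^ 2)) (v x) := by
    have h := ((((hasDerivAt_id (v x)).const_add 1).div ((hasDerivAt_id (v x)).const_sub 1)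
      hminus).log (div_ne_zero hplus hminus)).const_mul (1 / 2)
    refine h.congr_deriv ?_
    simp only [id, Pi.div_apply]
    field_simp
    ring
  exact (hlog.comp_hasFDerivAt x hv).add (hF.comp_hasFDerivAt x hρ)

/-- The key relation for resolving a left rarefaction wave in the GRP:
if `(ρ, v)` satisfies the primitive-variable system at a point, then
`(c_s/(ρ+p))∂ρ/∂t + (1/(1−v²))∂v/∂t
  = (λ₊/(λ₊−λ₋))(∂ψ₋/∂t + λ₋∂ψ₋/∂r) − (λ₋/(λ₊−λ₋))s₋`. -/
theorem stmt4 (p F : ℝ → ℝ)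
    (hp : ContDiffOn ℝ 1 p (Set.Ioi 0))
    (hp' : ∀ ω ∈ Set.Ioi (0 : ℝ), deriv p ω ∈ Set.Ioo (0 : ℝ) 1)
    (hF : ∀ ω ∈ Set.Ioi (0 : ℝ), HasDerivAt F (Real.sqrt (deriv p ω) / (ω + p ω)) ω)
    (A B : ℝ × ℝ → ℝ) (hA : ∀ x, 0 < A x) (hB : ∀ x, 0 < B x) (κ : ℝ)
    (ρ v : ℝ × ℝ → ℝ) (t r : ℝ) (hr : 0 < r)
    (hρ : DifferentiableAt ℝ ρ (t, r)) (hv : DifferentiableAt ℝ v (t, r))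
    (hρ0 : 0 < ρ (t, r)) (hv0 : |v (t, r)| < 1) :
    let x : ℝ × ℝ := (t, r)
    let ρ₀ : ℝ := ρ x
    let v₀ : ℝ := v x
    let p₀ : ℝ := p ρ₀
    let cs : ℝ := Real.sqrt (deriv p ρ₀)
    let sab : ℝ := Real.sqrt (A x * B x)
    let H₁ : ℝ := -(sab / (r * (1 - v₀ ^ 2 * cs ^ 2))) *
      (2 * v₀ * (ρ₀ + p₀) * (1 - κ * r ^ 2 * (ρ₀ + p₀) / (4 * A x)))
    let H₂ : ℝ := -(sab / (r * (1 - v₀ ^ 2 * cs ^ 2))) *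
      ((1 - v₀ ^ 2) * (-(2 * v₀ ^ 2 * cs ^ 2) +
        (1 - A x) * (1 - v₀ ^ 2 * cs ^ 2) / (2 * A x) +
        κ * r ^ 2 * (p₀ + ρ₀ * v₀ ^ 2 * cs ^ 2) / (2 * A x)))
    let lm : ℝ := sab * (v₀ - cs) / (1 - v₀ * cs)
    let lp : ℝ := sab * (v₀ + cs) / (1 + v₀ * cs)
    let ψm : ℝ × ℝ → ℝ := fun y => (1 / 2) * Real.log ((1 + v y) / (1 - v y)) + F (ρ y)
    let ψp : ℝ × ℝ → ℝ := fun y => (1 / 2) * Real.log ((1 + v y) / (1 - v y)) - F (ρ y)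
    let sm : ℝ := H₂ / (1 - v₀ ^ 2) + cs * H₁ / (ρ₀ + p₀)
    let sp : ℝ := H₂ / (1 - v₀ ^ 2) - cs * H₁ / (ρ₀ + p₀)
    (pdt ρ x + (sab / (1 - v₀ ^ 2 * cs ^ 2)) *
        (v₀ * (1 - cs ^ 2) * pdr ρ x + (ρ₀ + p₀) * pdr v x) = H₁) →
    (pdt v x + (sab / (1 - v₀ ^ 2 * cs ^ 2)) *
        ((1 - v₀ ^ 2) ^ 2 * cs ^ 2 / (ρ₀ + p₀) * pdr ρ x + v₀ * (1 - cs ^ 2) * pdr v x) = H₂) →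
    (cs / (ρ₀ + p₀)) * pdt ρ x + (1 / (1 - v₀ ^ 2)) * pdt v x =
      (lp / (lp - lm)) * (pdt ψm x + lm * pdr ψm x) - (lm / (lp - lm)) * sm := by
  intro x ρ₀ v₀ p₀ cs sab H₁ H₂ lm lp ψm ψp sm sp h₁ h₂
  have hd : ρ₀ + p₀ ≠ 0 :=
    add_ne_zero_of_hasDerivAt_sqrt_div hp (fun ω hω => (hp' ω hω).1) hF hρ0
  obtain ⟨hv₁, hv₂⟩ : -1 < v₀ ∧ v₀ < 1 := abs_lt.1 hv0
  have hc₀ : 0 < cs := Real.sqrt_pos.2 (hp' ρ₀ hρ0).1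
  have hc₁ : cs < 1 := (Real.sqrt_lt' one_pos).2 (by simpa using (hp' ρ₀ hρ0).2)
  have hs : 0 < sab := Real.sqrt_pos.2 (mul_pos (hA x) (hB x))
  have hu : 0 < 1 - v₀ ^ 2 := by nlinarith
  have hm : 0 < 1 - v₀ * cs := by nlinarith
  have hq : 0 < 1 + v₀ * cs := by nlinarith
  have hmq : 1 - v₀ ^ 2 * cs ^ 2 = (1 - v₀ * cs) * (1 + v₀ * cs) := by ring
  have hψ := hasFDerivAt_half_log_add_comp hρ.hasFDerivAt hv.hasFDerivAt (hF ρ₀ hρ0) hv0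
  have ht : pdt ψm x = 1 / (1 - v₀ ^ 2) * pdt v x + cs / (ρ₀ + p₀) * pdt ρ x := by
    simp only [pdt]
    rw [show fderiv ℝ ψm x = _ from hψ.fderiv]
    rfl
  have hr' : pdr ψm x = 1 / (1 - v₀ ^ 2) * pdr v x + cs / (ρ₀ + p₀) * pdr ρ x := by
    simp only [pdr]
    rw [show fderiv ℝ ψm x = _ from hψ.fderiv]
    rfl
  have hsub : lp - lm = 2 * sab * cs * (1 - v₀ ^ 2) / ((1 - v₀ * cs) * (1 + v₀ * cs)) := by
    simp only [lp, lm]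
    field_simp
    ring
  have hne : lp - lm ≠ 0 := by
    rw [hsub]
    positivity
  have hchar : pdt ψm x + lp * pdr ψm x = sm := by
    rw [ht, hr']
    simp only [sm]
    rw [← h₁, ← h₂, hmq]
    simp only [lp]
    field_simp
    ring
  have hL : cs / (ρ₀ + p₀) * pdt ρ x + 1 / (1 - v₀ ^ 2) * pdt v x = pdt ψm x := by
    rw [ht, add_comm]
  rw [hL, ← hchar]
  field_simp
  ring
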